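/- Uniform boundedness of the stiffened energies along the QIS iteration. Under the hypotheses of Theorem 2 (sequences (X^k), (t^k) satisfying the QIS update rule t^{k+1} = t^k + σ·(1 − t^k·f₊(X^{k+1}))/f₊(X^{k+1}), the monotone partial-minimization condition W(X^{k+1},t^k) ≤ W(X^k,t^k), and at each step either essential descent W(X^{k+1},t^k) ≤ (1−σ)W(X^k,t^k) or quasi-minimality inf_Y W(Y,t^k) > (1−σ)W(X^k,t^k)), with σ ∈ (0,1), t⁰·f₊(X⁰) < 1, a feasible pair t* ∈ (0,1), X* with t*·f₊(X*) < 1, and additionally t^k ≤ t* for all k ≤ K, one has W(X^K, t^K) ≤ max( W(X⁰, t⁰), (1−σ)^{-2}·W(X*, t*) ); in particular the sequence {W(X^k,t^k)} is bounded from above. -/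

import Mathlib

open Finset

/-- The worst-element distortion `f₊(X) = max_i f i X`. -/
noncomputable def fplus {ι E : Type*} [Fintype ι] [Nonempty ι]
    (f : ι → E → ℝ) (X : E) : ℝ :=
  Finset.univ.sup' Finset.univ_nonempty (fun i => f i X)

/-- The stiffened energy `W(X,t)`, with values in `[0,∞]`: it is
`Σᵢ vᵢ · (fᵢ X)/(1 - t·fᵢ X)` when `t·f₊(X) < 1`, and `+∞` when
`t·f₊(X) ≥ 1`. -/
noncomputable def W {ι E : Type*} [Fintype ι] [Nonempty ι]
    (v : ι → ℝ) (f : ι → E → ℝ) (X : E) (t : ℝ) : ENNReal :=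
  if t * fplus f X < 1 then
    ENNReal.ofReal (∑ i, v i * (f i X / (1 - t * f i X)))
  else ⊤

theorem le_fplus {ι E : Type*} [Fintype ι] [Nonempty ι]
    (f : ι → E → ℝ) (X : E) (i : ι) : f i X ≤ fplus f X :=
  Finset.le_sup' (fun i => f i X) (Finset.mem_univ i)

theorem exists_fplus_eq {ι E : Type*} [Fintype ι] [Nonempty ι]
    (f : ι → E → ℝ) (X : E) : ∃ i, fplus f X = f i X := by
  obtain ⟨i, -, h⟩ := Finset.exists_mem_eq_sup' Finset.univ_nonempty (fun i => f i X)
  exact ⟨i, h⟩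

theorem mul_fplus_lt_one_of_W_ne_top {ι E : Type*} [Fintype ι] [Nonempty ι]
    {v : ι → ℝ} {f : ι → E → ℝ} {X : E} {t : ℝ} (h : W v f X t ≠ ⊤) :
    t * fplus f X < 1 := by
  by_contra hlt
  exact h (if_neg hlt)

theorem W_ne_top {ι E : Type*} [Fintype ι] [Nonempty ι]
    (v : ι → ℝ) {f : ι → E → ℝ} {X : E} {t : ℝ} (h : t * fplus f X < 1) :
    W v f X t ≠ ⊤ := by
  rw [W, if_pos h]
  exact ENNReal.ofReal_ne_top

/-- If passing from `t` to `t'` shrinks every denominator of the energy by a factor at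
worst `c`, then the energy grows by a factor at most `c⁻¹`. -/
theorem W_le_inv_mul_W {ι E : Type*} [Fintype ι] [Nonempty ι]
    {v : ι → ℝ} (hv : ∀ i, 0 ≤ v i) {f : ι → E → ℝ} {X : E} (hf : ∀ i, 0 ≤ f i X)
    {t t' c : ℝ} (ht : 0 ≤ t) (hc : 0 < c) (hfeas : t * fplus f X < 1)
    (h : ∀ i, c * (1 - t * f i X) ≤ 1 - t' * f i X) :
    W v f X t' ≤ ENNReal.ofReal c⁻¹ * W v f X t := by
  have hpos : ∀ i, 0 < 1 - t * f i X := fun i => by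
    have := mul_le_mul_of_nonneg_left (le_fplus f X i) ht
    linarith
  have hfeas' : t' * fplus f X < 1 := by
    obtain ⟨i, hi⟩ := exists_fplus_eq f X
    rw [hi]
    linarith [h i, mul_pos hc (hpos i)]
  rw [W, W, if_pos hfeas, if_pos hfeas', ← ENNReal.ofReal_mul (inv_nonneg.2 hc.le)]
  refine ENNReal.ofReal_le_ofReal ?_
  rw [Finset.mul_sum]
  refine Finset.sum_le_sum fun i _ => ?_
  calc v i * (f i X / (1 - t' * f i X))
      ≤ v i * (f i X / (c * (1 - t * f i X))) :=
        mul_le_mul_of_nonneg_left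
          (div_le_div_of_nonneg_left (hf i) (mul_pos hc (hpos i)) (h i)) (hv i)
    _ = c⁻¹ * (v i * (f i X / (1 - t * f i X))) := by
        have := (hpos i).ne'
        field_simp

theorem W_mono {ι E : Type*} [Fintype ι] [Nonempty ι]
    {v : ι → ℝ} (hv : ∀ i, 0 ≤ v i) {f : ι → E → ℝ} {X : E} (hf : ∀ i, 0 ≤ f i X)
    {s t : ℝ} (hs : 0 ≤ s) (hst : s ≤ t) :
    W v f X s ≤ W v f X t := by
  by_cases hfeas : t * fplus f X < 1
  · have hfp : 0 ≤ fplus f X := by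
      obtain ⟨i, hi⟩ := exists_fplus_eq f X
      exact hi ▸ hf i
    have hs' : s * fplus f X < 1 := (mul_le_mul_of_nonneg_right hst hfp).trans_lt hfeas
    rw [W, W, if_pos hfeas, if_pos hs']
    refine ENNReal.ofReal_le_ofReal (Finset.sum_le_sum fun i _ => ?_)
    refine mul_le_mul_of_nonneg_left (div_le_div_of_nonneg_left (hf i) ?_ ?_) (hv i)
    · have := mul_le_mul_of_nonneg_left (le_fplus f X i) (hs.trans hst)
      linarith
    · have := mul_le_mul_of_nonneg_right hst (hf i)
      linarith
  · exact le_of_le_of_eq le_top (if_neg hfeas).symm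

/-- The QIS update of `t` increases the energy by a factor at most `(1 - σ)⁻¹`. -/
theorem W_update_le {ι E : Type*} [Fintype ι] [Nonempty ι]
    {v : ι → ℝ} (hv : ∀ i, 0 ≤ v i) {f : ι → E → ℝ} {X : E} (hf : ∀ i, 0 < f i X)
    {t σ : ℝ} (ht : 0 ≤ t) (hσ0 : 0 ≤ σ) (hσ1 : σ < 1) (hfeas : t * fplus f X < 1) :
    W v f X (t + σ * (1 - t * fplus f X) / fplus f X) ≤
      ENNReal.ofReal (1 - σ)⁻¹ * W v f X t := by
  refine W_le_inv_mul_W hv (fun i => (hf i).le) ht (sub_pos.2 hσ1) hfeas fun i => ?_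
  have hle := le_fplus f X i
  have hfp : 0 < fplus f X := (hf i).trans_le hle
  have hr : f i X / fplus f X ≤ 1 := (div_le_one hfp).2 hle
  have key : (t + σ * (1 - t * fplus f X) / fplus f X) * f i X =
      t * f i X + σ * (f i X / fplus f X) - σ * (t * f i X) := by
    field_simp
    ring
  rw [key]
  linarith [mul_le_mul_of_nonneg_left hr hσ0]

/-- Uniform boundedness of the stiffened energies along the QIS iteration:
as long as `t^k ≤ t*`, the energy `W(X^K, t^K)` is bounded by
`max( W(X⁰,t⁰), (1-σ)⁻²·W(X*,t*) )`. -/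
theorem qis_energy_uniformly_bounded
    {ι E : Type*} [Fintype ι] [Nonempty ι]
    (v : ι → ℝ) (hv : ∀ i, 0 < v i)
    (f : ι → E → ℝ) (hf : ∀ i X, 1 ≤ f i X)
    (tstar : ℝ) (htstar : tstar ∈ Set.Ioo (0:ℝ) 1)
    (Xstar : E) (hfeas : tstar * fplus f Xstar < 1)
    (σ : ℝ) (hσ : σ ∈ Set.Ioo (0:ℝ) 1)
    (X : ℕ → E) (t : ℕ → ℝ)
    (ht0 : 0 ≤ t 0) (ht0' : t 0 < tstar)
    (ht0f : t 0 * fplus f (X 0) < 1)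
    (hupd : ∀ k, t (k + 1) =
      t k + σ * (1 - t k * fplus f (X (k + 1))) / fplus f (X (k + 1)))
    (hmono : ∀ k, W v f (X (k + 1)) (t k) ≤ W v f (X k) (t k))
    (halt : ∀ k,
      W v f (X (k + 1)) (t k) ≤ ENNReal.ofReal (1 - σ) * W v f (X k) (t k) ∨
      (⨅ Y : E, W v f Y (t k)) > ENNReal.ofReal (1 - σ) * W v f (X k) (t k))
    (K : ℕ) (hK : ∀ k ≤ K, t k ≤ tstar) :
    W v f (X K) (t K) ≤
      max (W v f (X 0) (t 0))
        (ENNReal.ofReal ((1 - σ)⁻¹ ^ 2) * W v f Xstar tstar) := by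
  obtain ⟨hσ0, hσ1⟩ := hσ
  have hv' : ∀ i, 0 ≤ v i := fun i => (hv i).le
  have hf' : ∀ i Y, 0 < f i Y := fun i Y => one_pos.trans_le (hf i Y)
  have hc : 0 < 1 - σ := sub_pos.2 hσ1
  have hinv : ENNReal.ofReal (1 - σ)⁻¹ * ENNReal.ofReal (1 - σ) = 1 := by
    rw [← ENNReal.ofReal_mul (inv_nonneg.2 hc.le), inv_mul_cancel₀ hc.ne', ENNReal.ofReal_one]
  suffices h : 0 ≤ t K ∧ W v f (X K) (t K) ≤ max (W v f (X 0) (t 0))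
      (ENNReal.ofReal ((1 - σ)⁻¹ ^ 2) * W v f Xstar tstar) from h.2
  induction K with
  | zero => exact ⟨ht0, le_max_left _ _⟩
  | succ k ih =>
    obtain ⟨htk, hWk⟩ := ih fun j hj => hK j (hj.trans k.le_succ)
    have hbound : max (W v f (X 0) (t 0))
        (ENNReal.ofReal ((1 - σ)⁻¹ ^ 2) * W v f Xstar tstar) < ⊤ :=
      max_lt (W_ne_top v ht0f).lt_top
        (ENNReal.mul_lt_top ENNReal.ofReal_lt_top (W_ne_top v hfeas).lt_top)
    have hfk : t k * fplus f (X (k + 1)) < 1 :=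
      mul_fplus_lt_one_of_W_ne_top (((hmono k).trans hWk).trans_lt hbound).ne
    have hfp : 0 < fplus f (X (k + 1)) := by
      obtain ⟨i, hi⟩ := exists_fplus_eq f (X (k + 1))
      exact hi ▸ hf' i _
    have hstep := W_update_le hv' (fun i => hf' i (X (k + 1))) htk hσ0.le hσ1 hfk
    rw [← hupd k] at hstep
    refine ⟨?_, ?_⟩
    · rw [hupd k]
      exact add_nonneg htk (div_nonneg (mul_nonneg hσ0.le (sub_pos.2 hfk).le) hfp.le)
    rcases halt k with hdesc | hquasi
    · calc W v f (X (k + 1)) (t (k + 1))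
          ≤ ENNReal.ofReal (1 - σ)⁻¹ * (ENNReal.ofReal (1 - σ) * W v f (X k) (t k)) := by
            grw [hstep, hdesc]
        _ = W v f (X k) (t k) := by rw [← mul_assoc, hinv, one_mul]
        _ ≤ _ := hWk
    · refine le_max_of_le_right ?_
      have hstar : ENNReal.ofReal (1 - σ) * W v f (X k) (t k) ≤ W v f Xstar tstar :=
        (hquasi.le.trans (iInf_le _ Xstar)).trans
          (W_mono hv' (fun i => (hf' i Xstar).le) htk (hK k k.le_succ))
      calc W v f (X (k + 1)) (t (k + 1))
          ≤ ENNReal.ofReal (1 - σ)⁻¹ * W v f (X k) (t k) := by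
            grw [hstep, hmono k]
        _ = ENNReal.ofReal (1 - σ)⁻¹ * (ENNReal.ofReal (1 - σ)⁻¹ *
              (ENNReal.ofReal (1 - σ) * W v f (X k) (t k))) := by
            rw [← mul_assoc (ENNReal.ofReal (1 - σ)⁻¹) (ENNReal.ofReal (1 - σ)), hinv, one_mul]
        _ ≤ ENNReal.ofReal (1 - σ)⁻¹ * (ENNReal.ofReal (1 - σ)⁻¹ * W v f Xstar tstar) := by
            grw [hstar]
        _ = ENNReal.ofReal ((1 - σ)⁻¹ ^ 2) * W v f Xstar tstar := by
            rw [ENNReal.ofReal_pow (inv_nonneg.2 hc.le), sq, mul_assoc]
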